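/- arXiv:2010.10690 — 2 statements merged into one kernel-verified Lean document; each statement's English description precedes it below -/
import Mathlib

section
/- Let n and m be nonnegative integers with n ≠ m, and let p and q be real polynomials satisfying d/dt[(1−t²) p'(t)] = −n(n+1) p(t) and d/dt[(1−t²) q'(t)] = −m(m+1) q(t) for all real t. Then ∫_{−1}^1 p(t) q(t) dt = 0, i.e., p and q are orthogonal with respect to the Lebesgue measure on [−1,1]. -/
open Polynomial in
theorem Polynomial.hasDerivAt_one_sub_sq_mul_deriv (p : ℝ[X]) (t : ℝ) :
    HasDerivAt (fun s : ℝ => (1 - s ^ 2) * (derivative p).eval s)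
      (deriv (fun s : ℝ => (1 - s ^ 2) * deriv (fun u : ℝ => p.eval u) s) t) t := by
  have h : (fun s : ℝ => (1 - s ^ 2) * deriv (fun u : ℝ => p.eval u) s)
      = fun s : ℝ => (1 - s ^ 2) * (derivative p).eval s := by
    funext s
    rw [p.deriv]
  rw [h]
  exact DifferentiableAt.hasDerivAt
    (((differentiableAt_const _).sub (differentiableAt_id.pow 2)).mul
      (derivative p).differentiableAt)

/-- Lagrange's identity for the Legendre operator, integrated over `[-1, 1]`: the boundary terms
vanish, so eigenfunctions for different eigenvalues are orthogonal. -/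
theorem Polynomial.integral_mul_eq_zero_of_legendre_eigenvalue_ne {a b : ℝ} (hab : a ≠ b)
    (p q : Polynomial ℝ)
    (hp : ∀ t : ℝ, deriv (fun s : ℝ => (1 - s ^ 2) * deriv (fun u : ℝ => p.eval u) s) t
        = a * p.eval t)
    (hq : ∀ t : ℝ, deriv (fun s : ℝ => (1 - s ^ 2) * deriv (fun u : ℝ => q.eval u) s) t
        = b * q.eval t) :
    ∫ t in (-1 : ℝ)..1, p.eval t * q.eval t = 0 := by
  have hderiv : ∀ t : ℝ, HasDerivAt
      (fun s : ℝ => (1 - s ^ 2) * (derivative p).eval s * q.eval s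
        - (1 - s ^ 2) * (derivative q).eval s * p.eval s)
      ((a - b) * (p.eval t * q.eval t)) t := by
    intro t
    have hp' := p.hasDerivAt_one_sub_sq_mul_deriv t
    have hq' := q.hasDerivAt_one_sub_sq_mul_deriv t
    rw [hp] at hp'
    rw [hq] at hq'
    exact ((hp'.mul (q.hasDerivAt t)).sub (hq'.mul (p.hasDerivAt t))).congr_deriv (by ring)
  have hint := intervalIntegral.integral_eq_sub_of_hasDerivAt (a := -1) (b := 1)
    (fun t _ => hderiv t)
    ((continuous_const.mul (p.continuous.mul q.continuous)).intervalIntegrable _ _)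
  rw [intervalIntegral.integral_const_mul] at hint
  norm_num at hint
  exact hint.resolve_left (sub_ne_zero.mpr hab)

/-- Orthogonality of Legendre polynomials: if `p` and `q` are polynomial solutions
of the Legendre differential equations of parameters `n ≠ m`, then
`∫_{-1}^1 p(t) q(t) dt = 0`. -/
theorem legendre_orthogonal (n m : ℕ) (hnm : n ≠ m) (p q : Polynomial ℝ)
    (hp : ∀ t : ℝ, deriv (fun s : ℝ => (1 - s ^ 2) * deriv (fun u : ℝ => p.eval u) s) t
        = -((n : ℝ) * ((n : ℝ) + 1)) * p.eval t)
    (hq : ∀ t : ℝ, deriv (fun s : ℝ => (1 - s ^ 2) * deriv (fun u : ℝ => q.eval u) s) t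
        = -((m : ℝ) * ((m : ℝ) + 1)) * q.eval t) :
    ∫ t in (-1 : ℝ)..1, p.eval t * q.eval t = 0 := by
  refine Polynomial.integral_mul_eq_zero_of_legendre_eigenvalue_ne (fun h => hnm ?_) p q hp hq
  have h' : n * (n + 1) = m * (m + 1) := by exact_mod_cast neg_injective h
  rcases lt_trichotomy n m with hlt | heq | hgt
  · nlinarith
  · exact heq
  · nlinarith
end

section
/- For every nonnegative integer n, the Legendre differential equation has a unique polynomial solution up to a multiplicative constant: if p and q are real polynomials both satisfying (1−x²) y''(x) − 2x y'(x) + n(n+1) y(x) = 0 for all real x, then p and q are linearly dependent (there exist real c, d, not both zero, with c·p = d·q). -/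
open Polynomial in
theorem Polynomial.coeff_X_mul_derivative {R : Type*} [CommSemiring R] (p : R[X]) (k : ℕ) :
    (X * derivative p).coeff k = k * p.coeff k := by
  cases k with
  | zero => simp
  | succ k => rw [coeff_X_mul, coeff_derivative]; push_cast; ring

open Polynomial in
/-- The coefficient recursion satisfied by a polynomial solution of the Legendre equation. -/
theorem legendre_coeff_recursion (n : ℕ) (p : ℝ[X])
    (hp : ∀ x : ℝ, (1 - x ^ 2) * deriv (deriv (fun t : ℝ => p.eval t)) x
        - 2 * x * deriv (fun t : ℝ => p.eval t) x
        + (n : ℝ) * ((n : ℝ) + 1) * p.eval x = 0) (k : ℕ) :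
    ((k : ℝ) * (k + 1) - n * (n + 1)) * p.coeff k =
      p.coeff (k + 2) * (k + 2) * (k + 1) := by
  have hderiv (r : ℝ[X]) : deriv (fun t : ℝ => r.eval t) = fun t => (derivative r).eval t :=
    funext fun _ => r.deriv
  simp only [hderiv] at hp
  have h : derivative (derivative p) - X * derivative (X * derivative p) - X * derivative p
      + C ((n : ℝ) * (n + 1)) * p = 0 := by
    refine Polynomial.funext fun x => ?_
    simp only [derivative_mul, derivative_X, eval_add, eval_sub, eval_mul, eval_X, eval_C,
      eval_one, eval_zero]
    linear_combination hp x
  have hk := congrArg (fun r : ℝ[X] => r.coeff k) h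
  simp only [coeff_add, coeff_sub, coeff_X_mul_derivative, coeff_C_mul, coeff_derivative,
    coeff_zero] at hk
  push_cast at hk
  linear_combination -hk

open Polynomial in
/-- A polynomial whose coefficients satisfy the Legendre recursion vanishes as soon as its
coefficient of degree `n` does. -/
theorem eq_zero_of_legendre_coeff_recursion (n : ℕ) (r : ℝ[X])
    (hr : ∀ k : ℕ, ((k : ℝ) * (k + 1) - n * (n + 1)) * r.coeff k =
      r.coeff (k + 2) * (k + 2) * (k + 1)) (hn : r.coeff n = 0) : r = 0 := by
  by_contra h0
  have hlead : r.coeff r.natDegree ≠ 0 := leadingCoeff_ne_zero.mpr h0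
  have h := hr r.natDegree
  rw [coeff_eq_zero_of_natDegree_lt (by lia : r.natDegree < r.natDegree + 2), zero_mul,
    zero_mul] at h
  have hfactor : ((r.natDegree : ℝ) - n) * (r.natDegree + n + 1) = 0 := by
    linear_combination (mul_eq_zero.mp h).resolve_right hlead
  have hpos : (r.natDegree : ℝ) + n + 1 ≠ 0 := by positivity
  have hdeg : r.natDegree = n := by
    exact_mod_cast sub_eq_zero.mp ((mul_eq_zero.mp hfactor).resolve_right hpos)
  exact hlead (hdeg ▸ hn)

/-- For every nonnegative integer `n`, the Legendre differential equation has a unique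
polynomial solution up to a multiplicative constant: any two polynomial solutions
are linearly dependent. -/
theorem legendre_polynomial_solution_unique (n : ℕ) (p q : Polynomial ℝ)
    (hp : ∀ x : ℝ, (1 - x ^ 2) * deriv (deriv (fun t : ℝ => p.eval t)) x
        - 2 * x * deriv (fun t : ℝ => p.eval t) x
        + (n : ℝ) * ((n : ℝ) + 1) * p.eval x = 0)
    (hq : ∀ x : ℝ, (1 - x ^ 2) * deriv (deriv (fun t : ℝ => q.eval t)) x
        - 2 * x * deriv (fun t : ℝ => q.eval t) x
        + (n : ℝ) * ((n : ℝ) + 1) * q.eval x = 0) :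
    ∃ c d : ℝ, (c ≠ 0 ∨ d ≠ 0) ∧ c • p = d • q := by
  have hp' := legendre_coeff_recursion n p hp
  have hq' := legendre_coeff_recursion n q hq
  by_cases hpn : p.coeff n = 0
  · exact ⟨1, 0, Or.inl one_ne_zero, by
      simp [eq_zero_of_legendre_coeff_recursion n p hp' hpn]⟩
  · refine ⟨q.coeff n, p.coeff n, Or.inr hpn, sub_eq_zero.mp ?_⟩
    refine eq_zero_of_legendre_coeff_recursion n _ (fun k => ?_) ?_
    · simp only [Polynomial.coeff_sub, Polynomial.coeff_smul, smul_eq_mul]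
      linear_combination q.coeff n * hp' k - p.coeff n * hq' k
    · simp only [Polynomial.coeff_sub, Polynomial.coeff_smul, smul_eq_mul]
      ring
end
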